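/- (Tightness of the degradation factor for α ≥ 1.) For every α ≥ 1, at the utilization level z^u := T(1 + ln(γ)/α) the degradation bound holds with equality: T · Ψ_α(z^u) · (α + γ − 1) = α · γ · ∫₀^{z^u} Ψ_α(u) du, where Ψ_α(z^u) = U. -/

import Mathlib

/-- The parametric threshold function `Psi α` for the online knapsack problem:
`Psi α z = L` for `z < T` and `Psi α z = min U (L * exp (α * (z/T - 1)))` for `z ≥ T`. -/
noncomputable def Psi (L U T α z : ℝ) : ℝ :=
  if z < T then L else min U (L * Real.exp (α * (z / T - 1)))

lemma Psi_of_le {L U T α z : ℝ} (hT : 0 < T) (hLU : L ≤ U) (hz : z ≤ T) :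
    Psi L U T α z = L := by
  rcases hz.lt_or_eq with h | rfl
  · simp [Psi, h]
  · simp [Psi, div_self hT.ne', hLU]

lemma Psi_of_mem_Icc {L γ T α z : ℝ} (hL : 0 < L) (hγ : 0 < γ) (hT : 0 < T) (hα : 0 < α)
    (hz : z ∈ Set.Icc T (T * (1 + Real.log γ / α))) :
    Psi L (γ * L) T α z = L * Real.exp (α * (z / T - 1)) := by
  have hle : α * (z / T - 1) ≤ Real.log γ := by
    have h : z / T ≤ 1 + Real.log γ / α := (div_le_iff₀' hT).2 hz.2
    rw [← le_div_iff₀' hα]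
    linarith
  rw [Psi, if_neg hz.1.not_gt, min_eq_right]
  rw [mul_comm γ]
  exact mul_le_mul_of_nonneg_left ((Real.le_log_iff_exp_le hγ).1 hle) hL.le

lemma integral_mul_exp_scaled {L T α : ℝ} (hT : T ≠ 0) (hα : α ≠ 0) (a b : ℝ) :
    ∫ u in a..b, L * Real.exp (α * (u / T - 1)) =
      L * T / α * (Real.exp (α * (b / T - 1)) - Real.exp (α * (a / T - 1))) := by
  have hderiv (x : ℝ) : HasDerivAt (fun u => L * T / α * Real.exp (α * (u / T - 1)))
      (L * Real.exp (α * (x / T - 1))) x := by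
    refine (((((hasDerivAt_id' x).div_const T).sub_const 1).const_mul α).exp.const_mul
      (L * T / α)).congr_deriv ?_
    field_simp
  rw [intervalIntegral.integral_eq_sub_of_hasDerivAt (fun x _ => hderiv x)
    (Continuous.intervalIntegrable (by fun_prop) a b)]
  ring

lemma integral_Psi {L γ T α : ℝ} (hL : 0 < L) (hγ : 1 ≤ γ) (hT : 0 < T) (hα : 0 < α) :
    ∫ u in (0:ℝ)..(T * (1 + Real.log γ / α)), Psi L (γ * L) T α u =
      L * T * (α + γ - 1) / α := by
  have hγ0 : 0 < γ := by linarith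
  have hTz : T ≤ T * (1 + Real.log γ / α) :=
    le_mul_of_one_le_right hT.le (by have := Real.log_nonneg hγ; simp; positivity)
  have hlow : Set.EqOn (fun _ => L) (Psi L (γ * L) T α) (Set.uIcc 0 T) := fun u hu => by
    rw [Set.uIcc_of_le hT.le] at hu
    exact (Psi_of_le hT (le_mul_of_one_le_left hL.le hγ) hu.2).symm
  have hhigh : Set.EqOn (fun u => L * Real.exp (α * (u / T - 1))) (Psi L (γ * L) T α)
      (Set.uIcc T (T * (1 + Real.log γ / α))) := fun u hu => by
    rw [Set.uIcc_of_le hTz] at hu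
    exact (Psi_of_mem_Icc hL hγ0 hT hα hu).symm
  have hexp : α * (T * (1 + Real.log γ / α) / T - 1) = Real.log γ := by field_simp; ring
  rw [← intervalIntegral.integral_add_adjacent_intervals
      (intervalIntegrable_const.congr (hlow.mono Set.uIoc_subset_uIcc))
      ((Continuous.intervalIntegrable (by fun_prop) _ _).congr
        (hhigh.mono Set.uIoc_subset_uIcc)),
    ← intervalIntegral.integral_congr hlow, ← intervalIntegral.integral_congr hhigh,
    integral_mul_exp_scaled hT.ne' hα.ne', hexp, Real.exp_log hγ0, div_self hT.ne',
    intervalIntegral.integral_const, smul_eq_mul, sub_self, mul_zero, Real.exp_zero]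
  field_simp
  ring

/-- Tightness of the degradation factor for `α ≥ 1`: at `z^u := T*(1 + log γ / α)`
one has `Psi z^u = U` and `T * Psi z^u * (α + γ - 1) = α * γ * ∫ u in 0..z^u, Psi u`. -/
theorem OKP_degradation_factor_tight (L U γ T α : ℝ) (hL : 0 < L) (hLU : L < U)
    (hγ : γ = U / L) (hT : T = 1 / (Real.log γ + 1)) (hα : 1 ≤ α) :
    Psi L U T α (T * (1 + Real.log γ / α)) = U ∧
    T * Psi L U T α (T * (1 + Real.log γ / α)) * (α + γ - 1)
      = α * γ * ∫ u in (0:ℝ)..(T * (1 + Real.log γ / α)), Psi L U T α u := by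
  have hγ1 : 1 < γ := by rwa [hγ, one_lt_div hL]
  have hγ0 : 0 < γ := by linarith
  have hα0 : 0 < α := by linarith
  have hlog := Real.log_pos hγ1
  have hT0 : 0 < T := by rw [hT]; positivity
  obtain rfl : U = γ * L := by rw [hγ, div_mul_cancel₀ U hL.ne']
  have hmem : T * (1 + Real.log γ / α) ∈ Set.Icc T (T * (1 + Real.log γ / α)) :=
    ⟨le_mul_of_one_le_right hT0.le (by simp; positivity), le_rfl⟩
  have hexp : α * (T * (1 + Real.log γ / α) / T - 1) = Real.log γ := by field_simp; ring
  have hval : Psi L (γ * L) T α (T * (1 + Real.log γ / α)) = γ * L := by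
    rw [Psi_of_mem_Icc hL hγ0 hT0 hα0 hmem, hexp, Real.exp_log hγ0, mul_comm]
  refine ⟨hval, ?_⟩
  rw [hval, integral_Psi hL hγ1.le hT0 hα0]
  field_simp
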